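/- The sequence {G_m} satisfies property [P1] if and only if it satisfies property [Q3]. That is: ‖A_m − A_m^typ‖ = o(n_m) as m → ∞ if and only if the number of edges of G_m is at least (1 + o(1))·p·n_m²/2, the largest eigenvalue of A_m is (1 + o(1))·p·n_m, and all other eigenvalues of A_m are o(n_m) in absolute value as m → ∞. -/

import Mathlib

open Filter Asymptotics

/-- The spectral norm of a real matrix: the operator norm of the associated
operator on Euclidean space. -/
noncomputable def specNormR {d : ℕ} (A : Matrix (Fin d) (Fin d) ℝ) : ℝ :=
  ‖Matrix.toEuclideanCLM (𝕜 := ℝ) A‖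

open scoped Classical in
/-- The eigenvalues of a real symmetric matrix, listed in nondecreasing order
(junk value `0` if the matrix is not symmetric). -/
noncomputable def sortedEigs {n : ℕ} (A : Matrix (Fin n) (Fin n) ℝ) : Fin n → ℝ :=
  if h : A.IsHermitian then
    fun i => ((List.ofFn h.eigenvalues).mergeSort (· ≤ ·)).get ⟨i, by simp [i.isLt]⟩
  else fun _ => 0

/-- The largest eigenvalue of a real symmetric matrix, as the supremum of the
Rayleigh quotient over unit vectors. -/
noncomputable def lamMaxR {d : ℕ} (A : Matrix (Fin d) (Fin d) ℝ) : ℝ :=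
  ⨆ v : {v : EuclideanSpace ℝ (Fin d) // ‖v‖ = 1},
    inner (𝕜 := ℝ) (Matrix.toEuclideanCLM (𝕜 := ℝ) A v.1) v.1

open scoped RealInnerProductSpace

section Spectral

variable {ι E : Type*} [Fintype ι] [NormedAddCommGroup E] [InnerProductSpace ℝ E]
  {b : OrthonormalBasis ι ℝ E} {T : E →L[ℝ] E} {l : ι → ℝ}

lemma inner_apply_of_eigenbasis (hT : ∀ i, T (b i) = l i • b i) (x : E) (i : ι) :
    ⟪b i, T x⟫ = l i * ⟪b i, x⟫ := by
  classical
  conv_lhs => rw [← b.sum_repr' x]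
  simp only [map_sum, map_smul, hT, inner_sum, inner_smul_right,
    orthonormal_iff_ite.mp b.orthonormal]
  simp [mul_comm]

lemma inner_apply_self_of_eigenbasis (hT : ∀ i, T (b i) = l i • b i) (x : E) :
    ⟪T x, x⟫ = ∑ i, l i * ⟪b i, x⟫ ^ 2 := by
  rw [← b.sum_inner_mul_inner]
  refine Finset.sum_congr rfl fun i _ => ?_
  rw [real_inner_comm, inner_apply_of_eigenbasis hT]
  ring

/-- Removing one rank-one eigencomponent leaves an operator bounded by the other eigenvalues. -/
lemma norm_apply_sub_eigencomponent_le (hT : ∀ i, T (b i) = l i • b i) (t : ι) {M : ℝ}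
    (hM : 0 ≤ M) (hl : ∀ i, i ≠ t → |l i| ≤ M) (x : E) :
    ‖T x - (l t * ⟪b t, x⟫) • b t‖ ≤ M * ‖x‖ := by
  classical
  refine abs_le_of_sq_le_sq' ?_ (by positivity) |>.2
  rw [← b.sum_sq_inner_right, mul_pow, ← b.sum_sq_inner_right x, Finset.mul_sum]
  refine Finset.sum_le_sum fun i _ => ?_
  rw [inner_sub_right, inner_apply_of_eigenbasis hT, inner_smul_right,
    orthonormal_iff_ite.mp b.orthonormal]
  by_cases h : i = t
  · subst h
    simp only [if_true, mul_one, sub_self, zero_pow two_ne_zero]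
    positivity
  · simp only [h, if_false, mul_zero, sub_zero, mul_pow]
    have := sq_le_sq' (abs_le.mp (hl i h)).1 (abs_le.mp (hl i h)).2
    gcongr

/-- On the span of two eigenvectors there is a vector orthogonal to a given one. -/
lemma exists_inner_eq_zero_of_eigenbasis (hT : ∀ i, T (b i) = l i • b i) {i j : ι}
    (hij : i ≠ j) (hl : l i ≤ l j) (w : E) :
    ∃ x, x ≠ 0 ∧ ⟪w, x⟫ = 0 ∧ l i * ‖x‖ ^ 2 ≤ ⟪T x, x⟫ := by
  have key : ∀ α β : ℝ, ‖α • b i + β • b j‖ ^ 2 = α ^ 2 + β ^ 2 ∧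
      ⟪T (α • b i + β • b j), α • b i + β • b j⟫ = α ^ 2 * l i + β ^ 2 * l j := by
    intro α β
    have h1 := b.inner_eq_zero hij
    have h2 := b.inner_eq_zero hij.symm
    constructor
    · rw [← real_inner_self_eq_norm_sq]
      simp only [inner_add_left, inner_add_right, inner_smul_left, inner_smul_right, h1, h2,
        real_inner_self_eq_norm_sq, b.norm_eq_one]
      simp
      ring
    · simp only [map_add, map_smul, hT, inner_add_left, inner_add_right, inner_smul_left,
        inner_smul_right, h1, h2, real_inner_self_eq_norm_sq, b.norm_eq_one]
      simp
      ring
  by_cases h0 : ⟪w, b i⟫ = 0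
  · refine ⟨b i, b.orthonormal.ne_zero i, h0, ?_⟩
    simp [hT, inner_smul_left, b.norm_eq_one]
  · obtain ⟨k1, k2⟩ := key ⟪w, b j⟫ (-⟪w, b i⟫)
    refine ⟨⟪w, b j⟫ • b i + (-⟪w, b i⟫) • b j, fun h => ?_, ?_, ?_⟩
    · rw [h, norm_zero] at k1
      have := pow_pos (abs_pos.mpr h0) 2
      rw [sq_abs] at this
      nlinarith [sq_nonneg ⟪w, b j⟫]
    · rw [inner_add_right, inner_smul_right, inner_smul_right]
      ring
    · rw [k1, k2]
      nlinarith [sq_nonneg ⟪w, b i⟫]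

lemma norm_rank_one_sub_le {u j : E} (hu : ‖u‖ = 1) (hj : ‖j‖ = 1) (x : E) :
    ‖⟪u, x⟫ • u - ⟪j, x⟫ • j‖ ≤ 2 * √(2 * (1 - ⟪u, j⟫ ^ 2)) * ‖x‖ := by
  wlog hc : 0 ≤ ⟪u, j⟫ generalizing u
  · have := this (u := -u) (by simpa using hu) (by rw [inner_neg_left]; linarith)
    simpa [inner_neg_left] using this
  have hc1 : ⟪u, j⟫ ≤ 1 := by simpa [hu, hj] using real_inner_le_norm u j
  have hd : ‖u - j‖ ≤ √(2 * (1 - ⟪u, j⟫ ^ 2)) := by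
    refine Real.le_sqrt_of_sq_le ?_
    rw [norm_sub_sq_real, hu, hj]
    nlinarith
  have e : ⟪u, x⟫ • u - ⟪j, x⟫ • j = ⟪u, x⟫ • (u - j) + ⟪u - j, x⟫ • j := by
    rw [inner_sub_left, smul_sub, sub_smul]
    abel
  have h1 : |⟪u, x⟫| ≤ ‖x‖ := by simpa [hu] using abs_real_inner_le_norm u x
  have h2 : |⟪u - j, x⟫| ≤ ‖u - j‖ * ‖x‖ := abs_real_inner_le_norm _ x
  rw [e]
  refine (norm_add_le _ _).trans ?_
  rw [norm_smul, norm_smul, Real.norm_eq_abs, Real.norm_eq_abs, hj, mul_one]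
  have h3 := mul_le_mul_of_nonneg_right h1 (norm_nonneg (u - j))
  have h4 := mul_le_mul_of_nonneg_right hd (norm_nonneg x)
  linarith

end Spectral

lemma sortedEigs_eq {n : ℕ} {A : Matrix (Fin n) (Fin n) ℝ} (hA : A.IsHermitian) :
    sortedEigs A = hA.eigenvalues ∘ Tuple.sort hA.eigenvalues := by
  have h : (List.ofFn hA.eigenvalues).mergeSort (· ≤ ·) =
      List.ofFn (hA.eigenvalues ∘ Tuple.sort hA.eigenvalues) := by
    refine List.Perm.eq_of_pairwise' (r := (· ≤ ·)) (List.pairwise_mergeSort' _ _) ?_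
      ((List.mergeSort_perm _ _).trans (Equiv.Perm.ofFn_comp_perm _ _).symm)
    rw [List.pairwise_ofFn]
    exact fun i j hij => Tuple.monotone_sort hA.eigenvalues hij.le
  funext i
  rw [sortedEigs, dif_pos hA]
  simp [h]

lemma monotone_sortedEigs {n : ℕ} {A : Matrix (Fin n) (Fin n) ℝ} (hA : A.IsHermitian) :
    Monotone (sortedEigs A) := by
  rw [sortedEigs_eq hA]
  exact Tuple.monotone_sort _

lemma exists_sortedEigs_eigenbasis {n : ℕ} {A : Matrix (Fin n) (Fin n) ℝ} (hA : A.IsHermitian) :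
    ∃ b : OrthonormalBasis (Fin n) ℝ (EuclideanSpace ℝ (Fin n)),
      ∀ i, Matrix.toEuclideanCLM (𝕜 := ℝ) A (b i) = sortedEigs A i • b i := by
  refine ⟨hA.eigenvectorBasis.reindex (Tuple.sort hA.eigenvalues).symm, fun i => ?_⟩
  rw [sortedEigs_eq hA]
  apply WithLp.ofLp_injective
  simpa using hA.mulVec_eigenvectorBasis (Tuple.sort hA.eigenvalues i)

/-- The all-ones vector. -/
noncomputable def onesVec (n : ℕ) : EuclideanSpace ℝ (Fin n) := WithLp.toLp 2 fun _ => 1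

lemma norm_onesVec_sq (n : ℕ) : ‖onesVec n‖ ^ 2 = n := by
  simp [onesVec, EuclideanSpace.norm_sq_eq]

lemma inner_onesVec (n : ℕ) (x : EuclideanSpace ℝ (Fin n)) : ⟪onesVec n, x⟫ = ∑ i, x i := by
  simp [onesVec, PiLp.inner_apply]

lemma sum_entries_eq_inner {n : ℕ} (A : Matrix (Fin n) (Fin n) ℝ) :
    ∑ i, ∑ j, A i j = ⟪Matrix.toEuclideanCLM (𝕜 := ℝ) A (onesVec n), onesVec n⟫ := by
  rw [real_inner_comm, Matrix.inner_toEuclideanCLM]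
  simp [onesVec, dotProduct, Matrix.mulVec]

lemma toEuclideanCLM_typical {n : ℕ} (p : ℝ) (x : EuclideanSpace ℝ (Fin n)) :
    Matrix.toEuclideanCLM (𝕜 := ℝ)
      (Matrix.of fun i j : Fin n => if i = j then 0 else p : Matrix (Fin n) (Fin n) ℝ) x =
      (p * ⟪onesVec n, x⟫) • onesVec n - p • x := by
  rw [inner_onesVec]
  ext i
  have : ∀ j, (if i = j then 0 else p) * x j = p * x j - if i = j then p * x j else 0 := by
    intro j; split_ifs <;> simp
  simp [Matrix.mulVec, dotProduct, onesVec, this, Finset.sum_sub_distrib, Finset.mul_sum]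

section Deviation

variable {n : ℕ} {A : Matrix (Fin n) (Fin n) ℝ} {p : ℝ}

lemma abs_inner_sub_typical_le (x : EuclideanSpace ℝ (Fin n)) :
    |⟪Matrix.toEuclideanCLM (𝕜 := ℝ) A x, x⟫ - (p * ⟪onesVec n, x⟫ ^ 2 - p * ‖x‖ ^ 2)| ≤
      specNormR (A - Matrix.of fun i j => if i = j then 0 else p) * ‖x‖ ^ 2 := by
  set D := A - Matrix.of fun i j => if i = j then 0 else p with hD
  have h : ⟪Matrix.toEuclideanCLM (𝕜 := ℝ) D x, x⟫ = ⟪Matrix.toEuclideanCLM (𝕜 := ℝ) A x, x⟫ -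
      (p * ⟪onesVec n, x⟫ ^ 2 - p * ‖x‖ ^ 2) := by
    rw [hD, map_sub, sub_apply, toEuclideanCLM_typical, inner_sub_left,
      inner_sub_left, inner_smul_left, inner_smul_left, real_inner_self_eq_norm_sq]
    simp
    ring
  rw [← h]
  refine (abs_real_inner_le_norm _ _).trans ?_
  have := (Matrix.toEuclideanCLM (𝕜 := ℝ) D).le_opNorm x
  rw [specNormR]
  nlinarith [norm_nonneg x]

lemma sum_entries_lower_bound :
    p * n ^ 2 - p * n - n * specNormR (A - Matrix.of fun i j => if i = j then 0 else p) ≤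
      ∑ i, ∑ j, A i j := by
  have h := abs_inner_sub_typical_le (A := A) (p := p) (onesVec n)
  rw [← sum_entries_eq_inner, real_inner_self_eq_norm_sq, norm_onesVec_sq] at h
  linarith [(abs_le.mp h).1]

lemma lamMaxR_eq_sortedEigs (hA : A.IsHermitian) {t : Fin n} (ht : (t : ℕ) + 1 = n) :
    lamMaxR A = sortedEigs A t := by
  obtain ⟨b, hb⟩ := exists_sortedEigs_eigenbasis hA
  have hle : ∀ v : {v : EuclideanSpace ℝ (Fin n) // ‖v‖ = 1},
      ⟪Matrix.toEuclideanCLM (𝕜 := ℝ) A v.1, v.1⟫ ≤ sortedEigs A t := by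
    rintro ⟨v, hv⟩
    rw [inner_apply_self_of_eigenbasis hb]
    calc ∑ i, sortedEigs A i * ⟪b i, v⟫ ^ 2 ≤ ∑ i, sortedEigs A t * ⟪b i, v⟫ ^ 2 := by
          gcongr with i
          exact monotone_sortedEigs hA (Fin.le_def.mpr (by omega))
      _ = sortedEigs A t := by rw [← Finset.mul_sum, b.sum_sq_inner_right, hv]; simp
  have : Nonempty {v : EuclideanSpace ℝ (Fin n) // ‖v‖ = 1} := ⟨⟨b t, b.norm_eq_one t⟩⟩
  refine le_antisymm (ciSup_le hle) ?_
  refine le_ciSup_of_le ⟨_, Set.forall_mem_range.mpr hle⟩ ⟨b t, b.norm_eq_one t⟩ ?_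
  simp [hb, inner_smul_left, b.norm_eq_one]

lemma inner_onesVec_sq_le (x : EuclideanSpace ℝ (Fin n)) :
    ⟪onesVec n, x⟫ ^ 2 ≤ n * ‖x‖ ^ 2 := by
  have h := abs_real_inner_le_norm (onesVec n) x
  have := pow_le_pow_left₀ (abs_nonneg _) h 2
  rwa [sq_abs, mul_pow, norm_onesVec_sq] at this

lemma abs_sortedEigs_top_sub_le (hA : A.IsHermitian) (hp : 0 < p) {t : Fin n}
    (ht : (t : ℕ) + 1 = n) :
    |sortedEigs A t - p * n| ≤
      specNormR (A - Matrix.of fun i j => if i = j then 0 else p) + p := by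
  obtain ⟨b, hb⟩ := exists_sortedEigs_eigenbasis hA
  have hn : (0 : ℝ) < n := by exact_mod_cast (by omega : 0 < n)
  have h1 := (abs_le.mp (abs_inner_sub_typical_le (A := A) (p := p) (b t))).2
  have h2 := sum_entries_lower_bound (A := A) (p := p)
  have h3 := inner_onesVec_sq_le (b t)
  have h4 : ∑ i, ∑ j, A i j ≤ sortedEigs A t * n := by
    rw [sum_entries_eq_inner, inner_apply_self_of_eigenbasis hb, ← norm_onesVec_sq,
      ← b.sum_sq_inner_right, Finset.mul_sum]
    gcongr with i
    exact monotone_sortedEigs hA (Fin.le_def.mpr (by omega))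
  simp only [hb, inner_smul_left, real_inner_self_eq_norm_sq, b.norm_eq_one] at h1 h3
  simp at h1 h3
  refine abs_le.mpr ⟨?_, ?_⟩
  · refine le_of_mul_le_mul_right ?_ hn
    nlinarith
  · nlinarith

lemma abs_sortedEigs_le (hA : A.IsHermitian) (hp : 0 < p) {i : Fin n} (hi : (i : ℕ) + 1 < n) :
    |sortedEigs A i| ≤ specNormR (A - Matrix.of fun i j => if i = j then 0 else p) + p := by
  obtain ⟨b, hb⟩ := exists_sortedEigs_eigenbasis hA
  have h1 := (abs_le.mp (abs_inner_sub_typical_le (A := A) (p := p) (b i))).1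
  simp only [hb, inner_smul_left, real_inner_self_eq_norm_sq, b.norm_eq_one] at h1
  simp at h1
  obtain ⟨x, hx0, hwx, hx⟩ := exists_inner_eq_zero_of_eigenbasis hb
    (i := i) (j := ⟨i + 1, hi⟩) (by simp [Fin.ext_iff])
    (monotone_sortedEigs hA (Fin.le_def.mpr (by simp))) (onesVec n)
  have h2 := (abs_le.mp (abs_inner_sub_typical_le (A := A) (p := p) x)).2
  rw [hwx] at h2
  have hx2 : 0 < ‖x‖ ^ 2 := by positivity
  refine abs_le.mpr ⟨by nlinarith [sq_nonneg ⟪onesVec n, b i⟫], ?_⟩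
  refine le_of_mul_le_mul_right ?_ hx2
  nlinarith

lemma iSup_abs_sortedEigs_le (hA : A.IsHermitian) (hp : 0 < p) :
    ⨆ i : {i : Fin n // (i : ℕ) + 1 < n}, |sortedEigs A i.1| ≤
      specNormR (A - Matrix.of fun i j => if i = j then 0 else p) + p :=
  Real.iSup_le (fun i => abs_sortedEigs_le hA hp i.2)
    (add_nonneg (norm_nonneg _) hp.le)

lemma specNormR_sub_typical_le (hA : A.IsHermitian) (hp : 0 < p) (hn : 0 < n) {e : ℝ}
    (he : (1 + e) * (p * (n : ℝ) ^ 2 / 2) ≤ (∑ i, ∑ j, A i j) / 2) {M d : ℝ}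
    (hM : M = ⨆ i : {i : Fin n // (i : ℕ) + 1 < n}, |sortedEigs A i.1|)
    (hd : d = |lamMaxR A - p * n|) :
    specNormR (A - Matrix.of fun i j => if i = j then 0 else p) ≤
      M + d + p * n * (2 * √(2 * ((2 * d + M) / (p * n) + |e|))) + p := by
  obtain ⟨b, hb⟩ := exists_sortedEigs_eigenbasis hA
  have hn' : (0 : ℝ) < n := by exact_mod_cast hn
  have hpn : 0 < p * n := by positivity
  let t : Fin n := ⟨n - 1, by omega⟩
  have ht : (t : ℕ) + 1 = n := by simp only [t]; omega
  have hM0 : 0 ≤ M := hM ▸ Real.iSup_nonneg fun _ => abs_nonneg _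
  have hd0 : 0 ≤ d := hd ▸ abs_nonneg _
  have hl : ∀ i, i ≠ t → |sortedEigs A i| ≤ M := by
    intro i hi
    have hi' : (i : ℕ) + 1 < n := by
      have := i.2
      have : (i : ℕ) ≠ t := fun h => hi (Fin.ext h)
      omega
    rw [hM]
    exact le_ciSup (f := fun i : {i : Fin n // (i : ℕ) + 1 < n} => |sortedEigs A i.1|)
      (Set.finite_range _).bddAbove ⟨i, hi'⟩
  have hdl : |sortedEigs A t - p * n| = d := by rw [hd, lamMaxR_eq_sortedEigs hA ht]
  set μ := sortedEigs A t with hμ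
  set T := Matrix.toEuclideanCLM (𝕜 := ℝ) A with hTdef
  set w := onesVec n with hw
  have hT := norm_apply_sub_eigencomponent_le hb t hM0 hl
  set u := b t with hu
  have hu1 : ‖u‖ = 1 := b.norm_eq_one t
  have hsn : 0 < √(n : ℝ) := Real.sqrt_pos.mpr hn'
  have hsn2 : √(n : ℝ) ^ 2 = n := Real.sq_sqrt hn'.le
  have hwn : ‖w‖ = √(n : ℝ) := by rw [← norm_onesVec_sq, Real.sqrt_sq (norm_nonneg _)]
  obtain ⟨j, hj⟩ : ∃ j : EuclideanSpace ℝ (Fin n), w = √(n : ℝ) • j :=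
    ⟨(√(n : ℝ))⁻¹ • w, by rw [smul_smul, mul_inv_cancel₀ hsn.ne', one_smul]⟩
  have hj1 : ‖j‖ = 1 := by
    rw [hj, norm_smul, Real.norm_eq_abs, abs_of_pos hsn] at hwn
    exact mul_left_cancel₀ hsn.ne' (by rw [hwn, mul_one])
  have hjj (x : EuclideanSpace ℝ (Fin n)) : (p * ⟪w, x⟫) • w = (p * n) • ⟪j, x⟫ • j := by
    rw [hj, inner_smul_left, smul_smul, smul_smul]
    congr 1
    simp only [conj_trivial]
    linear_combination (p * ⟪j, x⟫) * hsn2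
  set c := ⟪u, j⟫ with hc
  have hc2 : c ^ 2 ≤ 1 := by
    rw [sq_le_one_iff_abs_le_one]
    simpa [hu1, hj1] using abs_real_inner_le_norm u j
  have hS : ∑ i, ∑ j, A i j ≤ n * (μ * c ^ 2 + M) := by
    have hTj := hT j
    rw [hj1, mul_one] at hTj
    have h1 := real_inner_le_norm (T j - (μ * ⟪u, j⟫) • u) j
    rw [inner_sub_left, inner_smul_left, hj1, mul_one, ← hc] at h1
    simp only [conj_trivial] at h1
    rw [sum_entries_eq_inner, ← hw, ← hTdef, hj, map_smul, inner_smul_left, inner_smul_right]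
    simp only [conj_trivial]
    rw [← mul_assoc, ← pow_two, hsn2]
    gcongr
    nlinarith
  have hdev : 1 - c ^ 2 ≤ (2 * d + M) / (p * n) + |e| := by
    have h1 : (1 + e) * (p * n) ≤ μ * c ^ 2 + M := by
      refine le_of_mul_le_mul_left ?_ hn'
      nlinarith
    rw [← sub_le_iff_le_add, le_div_iff₀ hpn]
    have h2 := abs_le.mp hdl.le
    have h3 := neg_abs_le e
    nlinarith
  rw [specNormR]
  refine ContinuousLinearMap.opNorm_le_bound _ (by positivity) fun x => ?_
  rw [map_sub, sub_apply, toEuclideanCLM_typical, ← hw, hjj, ← hTdef]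
  have e1 : T x - ((p * n) • ⟪j, x⟫ • j - p • x) = (T x - (μ * ⟪u, x⟫) • u) +
      (μ - p * n) • ⟪u, x⟫ • u + (p * n) • (⟪u, x⟫ • u - ⟪j, x⟫ • j) + p • x := by
    module
  have hux : |⟪u, x⟫| ≤ ‖x‖ := by simpa [hu1] using abs_real_inner_le_norm u x
  have b1 : ‖(μ - p * n) • ⟪u, x⟫ • u‖ ≤ d * ‖x‖ := by
    rw [norm_smul, norm_smul, Real.norm_eq_abs, Real.norm_eq_abs, hdl, hu1, mul_one]
    gcongr
  have b2 : ‖(p * n) • (⟪u, x⟫ • u - ⟪j, x⟫ • j)‖ ≤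
      p * n * (2 * √(2 * ((2 * d + M) / (p * n) + |e|))) * ‖x‖ := by
    rw [norm_smul, Real.norm_eq_abs, abs_of_pos hpn, mul_assoc (p * n)]
    gcongr
    refine (norm_rank_one_sub_le hu1 hj1 x).trans ?_
    gcongr
  have b3 : ‖p • x‖ = p * ‖x‖ := by rw [norm_smul, Real.norm_eq_abs, abs_of_pos hp]
  rw [e1]
  refine (norm_add₄_le).trans ?_
  rw [b3]
  linarith [hT x]

end Deviation

/-- **Quasi-randomness is concentration of the adjacency matrix.**
For a sequence of graphs `G_m` on `n_m → ∞` vertices with adjacency matrices `A m` and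
a fixed `p ∈ (0,1)`, property `[P1]`: `‖A m − p (1 1^* − I)‖ = o(n_m)`, holds if and
only if property `[Q3]` holds: `G_m` has at least `(1 + o(1)) p n_m² / 2` edges, the
largest eigenvalue of `A m` is `(1 + o(1)) p n_m`, and all the other eigenvalues are
`o(n_m)` in absolute value. -/
theorem quasirandom_iff_adjacency_concentration
    (nm : ℕ → ℕ) (hnm : Tendsto nm atTop atTop)
    (p : ℝ) (hp : p ∈ Set.Ioo (0 : ℝ) 1)
    (A : ∀ m, Matrix (Fin (nm m)) (Fin (nm m)) ℝ)
    (hherm : ∀ m, (A m).IsHermitian)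
    (h01 : ∀ m i j, A m i j = 0 ∨ A m i j = 1)
    (hdiag : ∀ m i, A m i i = 0) :
    (fun m => specNormR (A m - Matrix.of fun i j => if i = j then 0 else p))
        =o[atTop] (fun m => (nm m : ℝ))
    ↔
    ((∃ e : ℕ → ℝ, Tendsto e atTop (nhds 0) ∧
        ∀ m, (1 + e m) * (p * (nm m : ℝ) ^ 2 / 2) ≤ (∑ i, ∑ j, A m i j) / 2) ∧
      Tendsto (fun m => lamMaxR (A m) / (p * (nm m : ℝ))) atTop (nhds 1) ∧
      (fun m => ⨆ i : {i : Fin (nm m) // (i : ℕ) + 1 < nm m}, |sortedEigs (A m) i.1|)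
        =o[atTop] (fun m => (nm m : ℝ))) := by
  have hp0 : 0 < p := hp.1
  have hN : Tendsto (fun m => (nm m : ℝ)) atTop atTop := tendsto_natCast_atTop_atTop.comp hnm
  have hNpos : ∀ᶠ m in atTop, (0 : ℝ) < nm m := hN.eventually_gt_atTop 0
  have hlo (f : ℕ → ℝ) : f =o[atTop] (fun m => (nm m : ℝ)) ↔
      Tendsto (fun m => f m / nm m) atTop (nhds 0) :=
    isLittleO_iff_tendsto' (by filter_upwards [hNpos] with m hm h; exact absurd h hm.ne')
  have hpN : Tendsto (fun m => p / nm m) atTop (nhds 0) := hN.const_div_atTop p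
  rw [hlo, hlo]
  set s : ℕ → ℝ := fun m => specNormR (A m - Matrix.of fun i j => if i = j then 0 else p) with hs
  have hs0 : ∀ m, 0 ≤ s m := fun m => norm_nonneg _
  constructor
  · intro h
    change Tendsto (fun m => s m / nm m) atTop (nhds 0) at h
    have hsp : Tendsto (fun m => (s m + p) / nm m) atTop (nhds 0) := by
      simpa [add_div] using h.add hpN
    refine ⟨⟨fun m => -((s m + p) / nm m / p), by simpa using (hsp.div_const p).neg, fun m => ?_⟩,
      ?_, ?_⟩
    · have := sum_entries_lower_bound (A := A m) (p := p)
      refine le_trans (le_of_eq ?_) (div_le_div_of_nonneg_right this zero_le_two)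
      rcases eq_or_ne (nm m : ℝ) 0 with h0 | h0
      · simp [h0]
      · change _ = (p * nm m ^ 2 - p * nm m - nm m * s m) / 2
        field_simp
        ring
    · rw [tendsto_iff_norm_sub_tendsto_zero]
      refine squeeze_zero' (Eventually.of_forall fun m => norm_nonneg _) ?_
        (by simpa using hsp.div_const p)
      filter_upwards [hNpos] with m hm
      have hm' : 0 < nm m := by exact_mod_cast hm
      have := abs_sortedEigs_top_sub_le (hherm m) hp0 (t := ⟨nm m - 1, by omega⟩)
        (by simp only; omega)
      rw [← lamMaxR_eq_sortedEigs (hherm m) (by simp only; omega)] at this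
      have e1 : lamMaxR (A m) / (p * nm m) - 1 = (lamMaxR (A m) - p * nm m) / (p * nm m) := by
        field_simp
      rw [Real.norm_eq_abs, e1, abs_div, abs_of_pos (by positivity : 0 < p * (nm m : ℝ)),
        div_div, mul_comm (nm m : ℝ) p]
      gcongr
    · refine squeeze_zero (fun m => div_nonneg (Real.iSup_nonneg fun _ => abs_nonneg _)
        (Nat.cast_nonneg _)) (fun m => ?_) hsp
      exact div_le_div_of_nonneg_right (iSup_abs_sortedEigs_le (hherm m) hp0) (Nat.cast_nonneg _)
  · rintro ⟨⟨e, he, hE⟩, hL, hM⟩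
    set M : ℕ → ℝ := fun m =>
      ⨆ i : {i : Fin (nm m) // (i : ℕ) + 1 < nm m}, |sortedEigs (A m) i.1| with hMdef
    set d : ℕ → ℝ := fun m => |lamMaxR (A m) - p * nm m| with hddef
    have hd : Tendsto (fun m => d m / nm m) atTop (nhds 0) := by
      have h1 := ((hL.sub_const 1).abs.const_mul p)
      simp only [sub_self, abs_zero, mul_zero] at h1
      refine h1.congr' ?_
      filter_upwards [hNpos] with m hm
      have e1 : lamMaxR (A m) / (p * nm m) - 1 = (lamMaxR (A m) - p * nm m) / (p * nm m) := by
        field_simp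
      rw [e1, abs_div, abs_of_pos (by positivity : 0 < p * (nm m : ℝ))]
      simp only [hddef]
      field_simp
    have hη : Tendsto (fun m => 2 * (((2 * (d m / nm m) + M m / nm m) / p) + |e m|))
        atTop (nhds 0) := by
      simpa using ((((hd.const_mul 2).add hM).div_const p).add he.abs).const_mul 2
    have hB : Tendsto (fun m => M m / nm m + d m / nm m +
        p * (2 * √(2 * (((2 * (d m / nm m) + M m / nm m) / p) + |e m|))) + p / nm m)
        atTop (nhds 0) := by
      simpa using ((hM.add hd).add ((hη.sqrt.const_mul 2).const_mul p)).add hpN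
    refine squeeze_zero' (Eventually.of_forall fun m => div_nonneg (hs0 m) (Nat.cast_nonneg _))
      ?_ hB
    filter_upwards [hNpos] with m hm
    have := specNormR_sub_typical_le (hherm m) hp0 (by exact_mod_cast hm) (hE m)
      (M := M m) (d := d m) rfl rfl
    rw [div_le_iff₀ hm]
    refine this.trans (le_of_eq ?_)
    have e1 : (2 * d m + M m) / (p * nm m) = (2 * (d m / nm m) + M m / nm m) / p := by
      field_simp
    rw [e1]
    field_simp
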